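/- Let k ≥ 5 be an integer, λ₁,…,λ₇ positive real numbers, and ε > 0 sufficiently small. There is a constant C such that for all sufficiently large X and all τ with 0 < τ < 1: with P = X^{1/4−ε}, R = τ^{−2} X^{(5k−12)/(32k)} (log X)³, 𝔪 = {α ∈ ℝ : P/X < |α| < R}, and 𝔪₁ = {α ∈ 𝔪 : |S₂(λ₁α, ρ)| ≤ X^{3/7 + 2ε}}, one has ∫_{𝔪₁} |S₂(λ₁α, ρ) S₃(λ₂α) S₃(λ₃α) S₃(λ₄α) S₃(λ₅α) S₄(λ₆α) S_k(λ₇α)|² K_τ(α) dα ≤ C τ X^{13/6 + 2/k + 75/84 − 2/(7·m₂(k)) + ε}, where m₂(k) = 2⌈(2k/3 + 1 − ⌊2k/3⌋)·2^{⌊2k/3⌋−1}⌉ if k = 5, m₂(k) = 2⌈14k/3 − 20⌉ if k = 6 or 7, and m₂(k) = 2⌈(2k/3 − ⌊2k/3⌋/2)(⌊2k/3⌋ + 1)⌉ if k ≥ 8. -/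

import Mathlib

open MeasureTheory Finset
open scoped Classical

/-- `e(x) = exp(2πix)`. -/
noncomputable def e (x : ℝ) : ℂ := Complex.exp (2 * Real.pi * Complex.I * x)

/-- Fejér-type kernel `K_τ(α)`. -/
noncomputable def Kf (τ α : ℝ) : ℝ :=
  if α = 0 then τ ^ 2 else (Real.sin (Real.pi * τ * α) / (Real.pi * α)) ^ 2

/-- `ψ(m,z) = 1` if every prime factor of `m` is `≥ z`, else `0`. -/
noncomputable def psi (m : ℕ) (z : ℝ) : ℝ :=
  if ∀ p : ℕ, p.Prime → p ∣ m → z ≤ (p : ℝ) then 1 else 0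

/-- `z(p)` in the sieve weights. -/
noncomputable def zP (X : ℝ) (p : ℕ) : ℝ :=
  if (p : ℝ) < X ^ ((1:ℝ)/7) then X ^ ((5:ℝ)/28) * (p : ℝ) ^ (-(1:ℝ)/2)
  else if (p : ℝ) ≤ X ^ ((3:ℝ)/14) then (p : ℝ)
  else X ^ ((5:ℝ)/14) / (p : ℝ)

/-- The sieve function `ρ(m)` of Harman–Kumchev. -/
noncomputable def rho (X : ℝ) (m : ℕ) : ℝ :=
  psi m (X ^ ((5:ℝ)/42)) -
    ∑ p ∈ m.primeFactors.filter
        (fun p : ℕ => X ^ ((5:ℝ)/42) ≤ (p:ℝ) ∧ (p:ℝ) ≤ X ^ ((1:ℝ)/4)),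
      psi (m / p) (zP X p)

/-- `S_k(α) = Σ_{p ∈ [(ηX)^{1/k}, X^{1/k}]} (log p) e(p^k α)`, sum over primes. -/
noncomputable def SS (η X : ℝ) (k : ℕ) (α : ℝ) : ℂ :=
  ∑ p ∈ (Finset.Icc 1 ⌊X ^ ((1:ℝ)/(k:ℝ))⌋₊).filter
      (fun p : ℕ => p.Prime ∧ (η * X) ^ ((1:ℝ)/(k:ℝ)) ≤ (p : ℝ)),
    (Real.log p : ℂ) * e ((p : ℝ) ^ k * α)

/-- `S₂(α, ρ) = Σ_{m ∈ [(ηX)^{1/2}, X^{1/2}]} ρ(m) e(m²α)`. -/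
noncomputable def S2 (η X α : ℝ) : ℂ :=
  ∑ m ∈ (Finset.Icc 1 ⌊X ^ ((1:ℝ)/2)⌋₊).filter
      (fun m : ℕ => (η * X) ^ ((1:ℝ)/2) ≤ (m : ℝ)),
    (rho X m : ℂ) * e ((m : ℝ) ^ 2 * α)

/-- `S_r(α)` for real `r ≥ 1`. -/
noncomputable def Sr (η X r α : ℝ) : ℂ :=
  ∑ p ∈ (Finset.Icc 1 ⌊X ^ (1/r)⌋₊).filter
      (fun p : ℕ => p.Prime ∧ (η * X) ^ (1/r) ≤ (p : ℝ)),
    (Real.log p : ℂ) * e ((p : ℝ) ^ r * α)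

/-- `U_r(α)` for real `r ≥ 1`. -/
noncomputable def Ur (η X r α : ℝ) : ℂ :=
  ∑ n ∈ (Finset.Icc 1 ⌊X ^ (1/r)⌋₊).filter
      (fun n : ℕ => (η * X) ^ (1/r) ≤ (n : ℝ)),
    e ((n : ℝ) ^ r * α)

/-- Chebyshev's function `θ(x) = Σ_{p ≤ x} log p`. -/
noncomputable def theta (x : ℝ) : ℝ :=
  ∑ p ∈ (Finset.Icc 1 ⌊x⌋₊).filter Nat.Prime, Real.log p

/-- `J_r(X,h)`. -/
noncomputable def J (ε r X h : ℝ) : ℝ :=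
  ∫ x in Set.Icc (ε * X) X,
    (theta ((x + h) ^ (1/r)) - theta (x ^ (1/r)) - ((x + h) ^ (1/r) - x ^ (1/r))) ^ 2

/-- `T_n(α) = ∫_{(ηX)^{1/n}}^{X^{1/n}} e(t^n α) dt`. -/
noncomputable def T (η X : ℝ) (n : ℕ) (α : ℝ) : ℂ :=
  ∫ t in Set.Icc ((η * X) ^ ((1:ℝ)/(n:ℝ))) (X ^ ((1:ℝ)/(n:ℝ))), e (t ^ n * α)

/-- `m₁(k)`. -/
noncomputable def m1 (k : ℕ) : ℝ :=
  if k = 5 then 2 * (⌈343 * (k:ℝ) / 50 - 20⌉ : ℝ)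
  else 2 * (⌈(49 * (k:ℝ) / 50 - (⌊49 * (k:ℝ) / 50⌋ : ℝ) / 2)
      * ((⌊49 * (k:ℝ) / 50⌋ : ℝ) + 1)⌉ : ℝ)

/-- `σ(k) = 44/45 − 24/(25 m₁(k))`. -/
noncomputable def sigma' (k : ℕ) : ℝ := 44/45 - 24 / (25 * m1 k)

/-- `m(k)` depending on `δ`. -/
noncomputable def mδ (k : ℕ) (δ : ℝ) : ℝ :=
  if ⌊(k:ℝ) * δ⌋ ≤ 3 then
    2 * (⌈((k:ℝ) * δ + 1 - (⌊(k:ℝ) * δ⌋ : ℝ)) * (2:ℝ) ^ (⌊(k:ℝ) * δ - 1⌋)⌉ : ℝ)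
  else if ⌊(k:ℝ) * δ⌋ = 4 then 2 * (⌈7 * (k:ℝ) * δ - 20⌉ : ℝ)
  else 2 * (⌈((k:ℝ) * δ - (⌊(k:ℝ) * δ⌋ : ℝ)/2) * ((⌊(k:ℝ) * δ⌋ : ℝ) + 1)⌉ : ℝ)

/-- `m₂(k)`. -/
noncomputable def m2 (k : ℕ) : ℝ :=
  if k = 5 then
    2 * (⌈(2 * (k:ℝ)/3 + 1 - (⌊2 * (k:ℝ)/3⌋ : ℝ)) * (2:ℝ) ^ (⌊2 * (k:ℝ)/3⌋ - 1)⌉ : ℝ)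
  else if k ≤ 7 then 2 * (⌈14 * (k:ℝ)/3 - 20⌉ : ℝ)
  else 2 * (⌈(2 * (k:ℝ)/3 - (⌊2 * (k:ℝ)/3⌋ : ℝ)/2) * ((⌊2 * (k:ℝ)/3⌋ : ℝ) + 1)⌉ : ℝ)


theorem div_bound (δ : ℝ) (hδ : 0 < δ) :
    ∃ C : ℝ, 1 ≤ C ∧ ∀ n : ℕ, n ≠ 0 → (n.divisors.card : ℝ) ≤ C * (n : ℝ) ^ δ := by
  obtain ⟨T, hT⟩ := exists_nat_ge ((2:ℝ) ^ (1/δ))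
  have hl2 : 0 < Real.log 2 := Real.log_pos (by norm_num)
  set A : ℝ := 1 + 1 / (δ * Real.log 2) with hA
  have hA1 : 1 ≤ A := by
    have : 0 < 1 / (δ * Real.log 2) := by positivity
    linarith
  refine ⟨A ^ T, one_le_pow₀ hA1, fun n hn => ?_⟩
  have key : ∀ p ∈ n.primeFactors, ((n.factorization p + 1 : ℕ) : ℝ) ≤
      (if p < T then A else 1) * ((p : ℝ) ^ (n.factorization p)) ^ δ := by
    intro p hp
    have hpp := Nat.prime_of_mem_primeFactors hp
    have hp2 : (2:ℝ) ≤ p := by exact_mod_cast hpp.two_le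
    generalize n.factorization p = a
    have e1 : ((p : ℝ) ^ a) ^ δ = ((p:ℝ) ^ δ) ^ a := by
      rw [← Real.rpow_natCast, ← Real.rpow_natCast, ← Real.rpow_mul (by positivity),
        ← Real.rpow_mul (by positivity), mul_comm]
    rw [e1]
    split_ifs with h
    · have h1 : ((2:ℝ) ^ δ) ^ a ≤ ((p:ℝ) ^ δ) ^ a := by gcongr
      have h2 : 1 + (a:ℝ) * (δ * Real.log 2) ≤ ((2:ℝ) ^ δ) ^ a := by
        rw [Real.rpow_def_of_pos (by norm_num), ← Real.exp_nat_mul]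
        have := Real.add_one_le_exp ((a:ℝ) * (Real.log 2 * δ))
        linarith [this]
      calc ((a + 1 : ℕ) : ℝ) = a + 1 := by push_cast; ring
        _ ≤ A * (1 + (a:ℝ) * (δ * Real.log 2)) := by
          have : A * (1 + (a:ℝ) * (δ * Real.log 2)) = 1 + a * (δ * Real.log 2) + 1 / (δ * Real.log 2) + a := by
            rw [hA]; field_simp; ring
          rw [this]
          have : 0 ≤ a * (δ * Real.log 2) + 1 / (δ * Real.log 2) := by positivity
          linarith
        _ ≤ A * ((p:ℝ) ^ δ) ^ a := by
          gcongr
          linarith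
    · have h1 : (2:ℝ) ≤ (p:ℝ) ^ δ := by
        have : (2:ℝ) ^ (1/δ) ≤ p := hT.trans (by exact_mod_cast not_lt.mp h)
        calc (2:ℝ) = ((2:ℝ) ^ (1/δ)) ^ δ := by
              rw [← Real.rpow_mul (by norm_num)]; field_simp; simp
          _ ≤ _ := by gcongr
      rw [one_mul]
      calc ((a + 1 : ℕ) : ℝ) ≤ ((2 ^ a : ℕ) : ℝ) := by exact_mod_cast Nat.lt_two_pow_self
        _ = (2:ℝ) ^ a := by push_cast; ring
        _ ≤ _ := by gcongr
  rw [Nat.card_divisors hn]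
  push_cast
  calc ∏ x ∈ n.primeFactors, ((n.factorization x : ℝ) + 1)
      ≤ ∏ p ∈ n.primeFactors, ((if p < T then A else 1) * ((p : ℝ) ^ (n.factorization p)) ^ δ) := by
        apply Finset.prod_le_prod
        · intros; positivity
        · intro p hp; simpa using key p hp
    _ = (∏ p ∈ n.primeFactors, (if p < T then A else 1)) *
        (∏ p ∈ n.primeFactors, ((p : ℝ) ^ (n.factorization p))) ^ δ := by
        rw [Finset.prod_mul_distrib, Real.finsetProd_rpow]
        intros; positivity
    _ ≤ A ^ T * (n:ℝ) ^ δ := by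
        have h1 : (∏ p ∈ n.primeFactors, ((p : ℝ) ^ (n.factorization p))) = n := by
          have := Nat.prod_factorization_pow_eq_self hn
          conv_rhs => rw [← this]
          rw [Finsupp.prod, Nat.support_factorization]
          push_cast; rfl
        rw [h1]
        gcongr
        rw [Finset.prod_ite, Finset.prod_const, Finset.prod_const_one, mul_one]
        apply pow_le_pow_right₀ hA1
        calc _ ≤ (Finset.range T).card := by
              apply Finset.card_le_card
              intro p; simp
          _ = T := by simp

theorem sdiv_card (n : ℤ) (hn : n ≠ 0) (D : ℕ) (hD : n.natAbs.divisors.card ≤ D) :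
    ∃ s : Finset ℤ, s.card ≤ 2 * D ∧ ∀ d : ℤ, d ∣ n → d ∈ s := by
  refine ⟨n.natAbs.divisors.image (fun d : ℕ => (d:ℤ)) ∪ n.natAbs.divisors.image (fun d : ℕ => -(d:ℤ)), ?_, ?_⟩
  · refine (Finset.card_union_le _ _).trans ?_
    have h1 := Finset.card_image_le (s := n.natAbs.divisors) (f := fun d : ℕ => (d:ℤ))
    have h2 := Finset.card_image_le (s := n.natAbs.divisors) (f := fun d : ℕ => -(d:ℤ))
    omega
  · intro d hd
    have h : d.natAbs ∈ n.natAbs.divisors := by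
      rw [Nat.mem_divisors]
      exact ⟨Int.natAbs_dvd_natAbs.mpr hd, by simpa using hn⟩
    rw [Finset.mem_union, Finset.mem_image, Finset.mem_image]
    rcases Int.natAbs_eq d with h' | h'
    · left; exact ⟨_, h, h'.symm⟩
    · right; exact ⟨_, h, h'.symm⟩

theorem r_count (P : Finset ℕ) (N D : ℕ) (hP : ∀ p ∈ P, 1 ≤ p ∧ p ≤ N) (m : ℤ) (hm : m ≠ 0)
    (hD : m.natAbs.divisors.card ≤ D) :
    ((P ×ˢ P).filter (fun z : ℕ × ℕ => (z.1:ℤ)^3 - (z.2:ℤ)^3 = m)).card ≤ 2 * D := by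
  obtain ⟨s, hs, hs'⟩ := sdiv_card m hm D hD
  refine le_trans (Finset.card_le_card_of_injOn (t := s) (fun z => (z.1:ℤ) - z.2) ?_ ?_) hs
  · rintro ⟨a, b⟩ h
    simp only [Finset.coe_filter, Set.mem_ofPred_eq] at h
    apply hs'
    rw [← h.2]
    exact sub_dvd_pow_sub_pow _ _ 3
  · rintro ⟨a, b⟩ h ⟨a', b'⟩ h' heq
    simp only [Finset.coe_filter, Set.mem_ofPred_eq, Finset.mem_product] at h h' heq
    obtain ⟨⟨ha, hb⟩, h⟩ := h
    obtain ⟨⟨ha', hb'⟩, h'⟩ := h'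
    have pa := (hP a ha).1
    have pb' := (hP b' hb').1
    have hne : (a:ℤ) - b ≠ 0 := by
      intro h0
      apply hm
      rw [← h, sub_eq_zero.mp h0]; ring
    have hpos : (a:ℤ) + b' ≠ 0 := by omega
    have h3 : 3 * ((a:ℤ) - b) * ((b:ℤ) - b') * ((a:ℤ) + b') = 0 := by
      have : (a':ℤ) = a - b + b' := by linarith
      rw [this] at h'
      linear_combination h - h'
    have : (b:ℤ) - b' = 0 := by
      simpa [hne, hpos] using h3
    have e1 : b = b' := by omega
    have e2 : a = a' := by omega
    rw [e1, e2]

theorem c_count (P : Finset ℕ) (N D : ℕ) (hP : ∀ p ∈ P, 1 ≤ p ∧ p ≤ N) (n : ℤ) (hn : n ≠ 0)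
    (hD : n.natAbs.divisors.card ≤ D) :
    (((P ×ˢ P) ×ˢ (P ×ˢ P)).filter (fun z : (ℕ × ℕ) × (ℕ × ℕ) =>
      (z.1.1:ℤ) - z.1.2 = (z.2.1:ℤ) - z.2.2 ∧
      (z.1.1:ℤ)^3 - (z.1.2:ℤ)^3 - ((z.2.1:ℤ)^3 - (z.2.2:ℤ)^3) = n)).card ≤ (2 * D) * (2 * D) := by
  obtain ⟨s, hs, hs'⟩ := sdiv_card n hn D hD
  have hss : (s ×ˢ s).card ≤ (2 * D) * (2 * D) := by
    rw [Finset.card_product]; exact Nat.mul_le_mul hs hs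
  have fac : ∀ a b a' b' : ℤ, a - b = a' - b' →
      a^3 - b^3 - (a'^3 - b'^3) = 3 * (a - b) * (b - b') * (a + b') := by
    intro a b a' b' h
    have : a' = a - b + b' := by linarith
    rw [this]; ring
  refine le_trans (Finset.card_le_card_of_injOn (t := s ×ˢ s)
    (fun z => ((z.1.1:ℤ) - z.1.2, (z.1.2:ℤ) - z.2.2)) ?_ ?_) hss
  · rintro ⟨⟨a, b⟩, ⟨a', b'⟩⟩ h
    simp only [Finset.coe_filter, Set.mem_ofPred_eq] at h
    obtain ⟨-, h1, h2⟩ := h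
    rw [fac _ _ _ _ h1] at h2
    simp only [Finset.coe_product, Set.mem_prod, Finset.mem_coe]
    constructor
    · apply hs'; exact ⟨3 * ((b:ℤ) - b') * (a + b'), by rw [← h2]; ring⟩
    · apply hs'; exact ⟨3 * ((a:ℤ) - b) * (a + b'), by rw [← h2]; ring⟩
  · rintro ⟨⟨a, b⟩, ⟨a', b'⟩⟩ h ⟨⟨c, d⟩, ⟨c', d'⟩⟩ h' heq
    simp only [Finset.coe_filter, Set.mem_ofPred_eq, Prod.mk.injEq] at h h' heq
    obtain ⟨-, h1, h2⟩ := h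
    obtain ⟨-, h1', h2'⟩ := h'
    rw [fac _ _ _ _ h1] at h2
    rw [fac _ _ _ _ h1'] at h2'
    obtain ⟨q1, q2⟩ := heq
    rw [← q1, ← q2] at h2'
    have hne : 3 * ((a:ℤ) - b) * ((b:ℤ) - b') ≠ 0 := by
      intro h0; apply hn; rw [← h2, h0, zero_mul]
    have := mul_left_cancel₀ hne (h2.trans h2'.symm)
    simp only [Prod.mk.injEq]
    omega

theorem c_zero (P : Finset ℕ) (N : ℕ) (hP : ∀ p ∈ P, 1 ≤ p ∧ p ≤ N) (hN : P.card ≤ N) :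
    (((P ×ˢ P) ×ˢ (P ×ˢ P)).filter (fun z : (ℕ × ℕ) × (ℕ × ℕ) =>
      (z.1.1:ℤ) - z.1.2 = (z.2.1:ℤ) - z.2.2 ∧
      (z.1.1:ℤ)^3 - (z.1.2:ℤ)^3 - ((z.2.1:ℤ)^3 - (z.2.2:ℤ)^3) = 0)).card ≤ 2 * (N * N) := by
  have hc : (P ×ˢ P).card ≤ N * N := by
    rw [Finset.card_product]; exact Nat.mul_le_mul hN hN
  refine le_trans (Finset.card_le_card (t := (P ×ˢ P).image (fun z => ((z.1,z.1),(z.2,z.2))) ∪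
    (P ×ˢ P).image (fun z => ((z.1,z.2),(z.1,z.2)))) ?_) ?_
  · rintro ⟨⟨a, b⟩, ⟨a', b'⟩⟩ h
    simp only [Finset.mem_filter, Finset.mem_product] at h
    obtain ⟨⟨⟨ha, hb⟩, ha', hb'⟩, h1, h2⟩ := h
    have pa := (hP a ha).1
    have h3 : 3 * ((a:ℤ) - b) * ((b:ℤ) - b') * ((a:ℤ) + b') = 0 := by
      have : (a':ℤ) = a - b + b' := by linarith
      rw [this] at h2
      linear_combination h2
    have hpos : (a:ℤ) + b' ≠ 0 := by omega
    simp only [Finset.mem_union, Finset.mem_image, Finset.mem_product, Prod.exists, Prod.mk.injEq]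
    have h4 : (a:ℤ) - b = 0 ∨ (b:ℤ) - b' = 0 := by simpa [hpos] using h3
    rcases h4 with h4 | h4
    · left; exact ⟨a, a', ⟨ha, ha'⟩, by omega⟩
    · right; exact ⟨a, b, ⟨ha, hb⟩, by omega⟩
  · refine (Finset.card_union_le _ _).trans ?_
    have h1 := Finset.card_image_le (s := P ×ˢ P) (f := fun z => ((z.1,z.1),(z.2,z.2)))
    have h2 := Finset.card_image_le (s := P ×ˢ P) (f := fun z => ((z.1,z.2),(z.1,z.2)))
    omega

theorem cube_bd {N a : ℕ} (h : a ≤ N) : (0:ℤ) ≤ (a:ℤ)^3 ∧ (a:ℤ)^3 ≤ (N:ℤ)^3 :=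
  ⟨by positivity, by exact_mod_cast Nat.pow_le_pow_left h 3⟩

theorem E_count (P : Finset ℕ) (N D : ℕ) (hP : ∀ p ∈ P, 1 ≤ p ∧ p ≤ N) (hN : P.card ≤ N)
    (hD : ∀ n : ℕ, n ≠ 0 → n ≤ 2 * N ^ 3 → n.divisors.card ≤ D) :
    (((P ×ˢ P) ×ˢ (P ×ˢ P)).filter (fun y : (ℕ × ℕ) × (ℕ × ℕ) =>
      (y.2.1:ℤ)^3 + (y.2.2:ℤ)^3 - ((y.1.1:ℤ)^3 + (y.1.2:ℤ)^3) = 0)).card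
      ≤ N * N + N * N * (2 * D) := by
  have hc : (P ×ˢ P).card ≤ N * N := by
    rw [Finset.card_product]; exact Nat.mul_le_mul hN hN
  rw [Finset.card_eq_sum_card_fiberwise (t := P ×ˢ P) (f := fun y => (y.1.2, y.2.2))]
  swap
  · rintro ⟨⟨a, b⟩, ⟨a', b'⟩⟩ h
    simp only [Finset.coe_filter, Set.mem_ofPred_eq, Finset.mem_product] at h
    simp [h.1.1.2, h.1.2.2]
  calc _ ≤ ∑ z ∈ P ×ˢ P, ((if z.1 = z.2 then N else 0) + 2 * D) := by
        apply Finset.sum_le_sum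
        rintro ⟨u, v⟩ hz
        rw [Finset.mem_product] at hz
        by_cases huv : u = v
        · subst huv
          simp only [if_true]
          refine le_trans ?_ (Nat.le_add_right _ _)
          refine le_trans (Finset.card_le_card_of_injOn (t := P) (fun z => z.1.1) ?_ ?_) hN
          · rintro ⟨⟨a, b⟩, ⟨a', b'⟩⟩ h
            simp only [Finset.coe_filter, Set.mem_ofPred_eq, Finset.mem_filter,
              Finset.mem_product] at h
            exact h.1.1.1.1
          · rintro ⟨⟨a, b⟩, ⟨a', b'⟩⟩ h ⟨⟨c, d⟩, ⟨c', d'⟩⟩ h' heq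
            simp only [Finset.coe_filter, Set.mem_ofPred_eq, Finset.mem_filter,
              Finset.mem_product, Prod.mk.injEq] at h h' heq
            obtain ⟨⟨-, h1⟩, h2, h3⟩ := h
            obtain ⟨⟨-, h1'⟩, h2', h3'⟩ := h'
            subst h2 h3 h2' heq
            subst h3'
            have t1 : a' ^ 3 = a ^ 3 := by zify; linarith
            have t2 : c' ^ 3 = a ^ 3 := by zify; linarith
            have t3 := Nat.pow_left_injective (n := 3) (by norm_num) t1
            have t4 := Nat.pow_left_injective (n := 3) (by norm_num) t2
            simp [t3, t4]
        · have hm : (v:ℤ)^3 - (u:ℤ)^3 ≠ 0 := by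
            intro h0
            have : v ^ 3 = u ^ 3 := by zify; linarith
            exact huv (Nat.pow_left_injective (n := 3) (by norm_num) this).symm
          simp only [huv, if_false, zero_add]
          have hr := r_count P N D hP ((v:ℤ)^3 - (u:ℤ)^3) hm (by
            apply hD _ (by omega)
            have := cube_bd (hP _ hz.1).2
            have := cube_bd (hP _ hz.2).2
            zify
            rw [abs_le]; constructor <;> linarith)
          refine le_trans (Finset.card_le_card_of_injOn (fun z => (z.1.1, z.2.1)) ?_ ?_) hr
          · rintro ⟨⟨a, b⟩, ⟨a', b'⟩⟩ h
            simp only [Finset.coe_filter, Set.mem_ofPred_eq, Finset.mem_filter,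
              Finset.mem_product, Prod.mk.injEq] at h ⊢
            obtain ⟨⟨h0, h1⟩, h2, h3⟩ := h
            subst h2 h3
            exact ⟨⟨h0.1.1, h0.2.1⟩, by linarith⟩
          · rintro ⟨⟨a, b⟩, ⟨a', b'⟩⟩ h ⟨⟨c, d⟩, ⟨c', d'⟩⟩ h' heq
            simp only [Finset.coe_filter, Set.mem_ofPred_eq, Finset.mem_filter,
              Finset.mem_product, Prod.mk.injEq] at h h' heq ⊢
            omega
    _ ≤ _ := by
        rw [Finset.sum_add_distrib, Finset.sum_const, smul_eq_mul]
        gcongr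
        rw [Finset.sum_product]
        calc _ = ∑ x ∈ P, N := by
              apply Finset.sum_congr rfl
              intro x hx
              simp [hx]
          _ ≤ _ := by rw [Finset.sum_const, smul_eq_mul]; gcongr

theorem M_count (P : Finset ℕ) (N D : ℕ) (hP : ∀ p ∈ P, 1 ≤ p ∧ p ≤ N) (hN : P.card ≤ N)
    (hD : ∀ n : ℕ, n ≠ 0 → n ≤ 2 * N ^ 3 → n.divisors.card ≤ D) :
    ((((P ×ˢ P) ×ˢ (P ×ˢ P)) ×ˢ ((P ×ˢ P) ×ˢ (P ×ˢ P))).filter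
      (fun t : ((ℕ × ℕ) × (ℕ × ℕ)) × ((ℕ × ℕ) × (ℕ × ℕ)) =>
      (t.1.1.1:ℤ) - t.1.1.2 = (t.2.1.1:ℤ) - t.2.1.2 ∧
      (t.1.1.1:ℤ)^3 - (t.1.1.2:ℤ)^3 + ((t.1.2.1:ℤ)^3 + (t.1.2.2:ℤ)^3) =
      (t.2.1.1:ℤ)^3 - (t.2.1.2:ℤ)^3 + ((t.2.2.1:ℤ)^3 + (t.2.2.2:ℤ)^3))).card
      ≤ 2 * (N * N) * (N * N + N * N * (2 * D)) + (N * N) * (N * N) * ((2 * D) * (2 * D)) := by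
  have hc : (P ×ˢ P).card ≤ N * N := by
    rw [Finset.card_product]; exact Nat.mul_le_mul hN hN
  have hc2 : ((P ×ˢ P) ×ˢ (P ×ˢ P)).card ≤ (N * N) * (N * N) := by
    rw [Finset.card_product]; exact Nat.mul_le_mul hc hc
  rw [Finset.card_eq_sum_card_fiberwise (t := (P ×ˢ P) ×ˢ (P ×ˢ P)) (f := fun t => (t.1.2, t.2.2))]
  swap
  · rintro ⟨⟨x, y⟩, ⟨x', y'⟩⟩ h
    simp only [Finset.coe_filter, Set.mem_ofPred_eq, Finset.mem_product (p := (_ : _ × _))] at h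
    have := h.1
    simp only [Finset.coe_product, Set.mem_prod, Finset.mem_coe, Finset.mem_product] at this ⊢
    tauto
  set c : ((ℕ × ℕ) × (ℕ × ℕ)) → ℤ := fun y =>
    (y.2.1:ℤ)^3 + (y.2.2:ℤ)^3 - ((y.1.1:ℤ)^3 + (y.1.2:ℤ)^3) with hcdef
  calc _ ≤ ∑ y ∈ (P ×ˢ P) ×ˢ (P ×ˢ P),
        ((if c y = 0 then 2 * (N * N) else 0) + (2 * D) * (2 * D)) := by
        apply Finset.sum_le_sum
        rintro y hy
        refine le_trans (Finset.card_le_card_of_injOn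
          (t := (((P ×ˢ P) ×ˢ (P ×ˢ P)).filter (fun z : (ℕ × ℕ) × (ℕ × ℕ) =>
            (z.1.1:ℤ) - z.1.2 = (z.2.1:ℤ) - z.2.2 ∧
            (z.1.1:ℤ)^3 - (z.1.2:ℤ)^3 - ((z.2.1:ℤ)^3 - (z.2.2:ℤ)^3) = c y)))
          (fun t => (t.1.1, t.2.1)) ?_ ?_) ?_
        · rintro ⟨⟨p, q⟩, ⟨p', q'⟩⟩ h
          simp only [Finset.coe_filter, Set.mem_ofPred_eq, Finset.mem_filter,
              Finset.mem_product] at h ⊢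
          obtain ⟨⟨h0, h1, h2⟩, h3⟩ := h
          subst h3
          refine ⟨⟨h0.1.1, h0.2.1⟩, h1, ?_⟩
          simp only [hcdef]
          linarith
        · rintro ⟨⟨p, q⟩, ⟨p', q'⟩⟩ h ⟨⟨r, s⟩, ⟨r', s'⟩⟩ h' heq
          simp only [Finset.coe_filter, Set.mem_ofPred_eq, Finset.mem_filter] at h h' heq
          have := h.2.trans h'.2.symm
          simp only [Prod.mk.injEq] at this heq
          simp only [this, heq]
        · by_cases h0 : c y = 0
          · rw [h0]
            simp only [if_true]
            exact (c_zero P N hP hN).trans (Nat.le_add_right _ _)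
          · simp only [h0, if_false, zero_add]
            apply c_count P N D hP _ h0
            apply hD _ (by omega)
            obtain ⟨⟨a, b⟩, ⟨a', b'⟩⟩ := y
            simp only [Finset.mem_product] at hy
            have := cube_bd (hP _ hy.1.1).2
            have := cube_bd (hP _ hy.1.2).2
            have := cube_bd (hP _ hy.2.1).2
            have := cube_bd (hP _ hy.2.2).2
            zify
            simp only [hcdef]
            rw [abs_le]; constructor <;> linarith
    _ ≤ _ := by
        rw [Finset.sum_add_distrib, Finset.sum_const, smul_eq_mul, ← Finset.sum_filter,
          Finset.sum_const, smul_eq_mul, mul_comm (Finset.card _) (2 * (N * N))]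
        have := E_count P N D hP hN hD
        gcongr

theorem e_add (x y : ℝ) : e (x + y) = e x * e y := by
  unfold e; rw [← Complex.exp_add]; congr 1; push_cast; ring

theorem e_conj (x : ℝ) : (starRingEnd ℂ) (e x) = e (-x) := by
  unfold e; rw [← Complex.exp_conj]; congr 1; simp [map_ofNat]

theorem e_norm (x : ℝ) : ‖e x‖ = 1 := by
  unfold e
  have : (2 * Real.pi * Complex.I * x : ℂ) = ((2 * Real.pi * x : ℝ) : ℂ) * Complex.I := by
    push_cast; ring
  rw [this, Complex.norm_exp_ofReal_mul_I]

theorem e_cont : Continuous e := by unfold e; fun_prop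

theorem e_int (n : ℤ) : e n = 1 := by
  unfold e
  rw [Complex.exp_eq_one_iff]
  exact ⟨n, by push_cast; ring⟩

theorem e_integral (m : ℤ) : ∫ x in (0:ℝ)..1, e ((m:ℝ) * x) = if m = 0 then 1 else 0 := by
  split_ifs with h
  · subst h; simp [e]
  · have hc : (2 * Real.pi * Complex.I * m : ℂ) ≠ 0 := by
      simp [h, Real.pi_ne_zero]
    have := integral_exp_mul_complex (a := 0) (b := 1) hc
    have h2 : ∀ x : ℝ, e ((m:ℝ) * x) = Complex.exp (2 * Real.pi * Complex.I * m * x) := by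
      intro x; unfold e; congr 1; push_cast; ring
    simp_rw [h2, this]
    have h3 : Complex.exp (2 * Real.pi * Complex.I * m * (1:ℝ)) = 1 := by
      have := e_int m
      unfold e at this
      simpa using this
    rw [h3]; simp

theorem parseval {ι : Type*} (A : Finset ι) (w : ι → ℝ) (n : ι → ℤ) :
    ∫ x in (0:ℝ)..1, ‖∑ a ∈ A, (w a : ℂ) * e ((n a : ℝ) * x)‖ ^ 2 =
      ∑ a ∈ A, ∑ b ∈ A, if n a = n b then w a * w b else 0 := by
  have h1 : ∀ x : ℝ, ((‖∑ a ∈ A, (w a : ℂ) * e ((n a : ℝ) * x)‖ ^ 2 : ℝ) : ℂ) =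
      ∑ a ∈ A, ∑ b ∈ A, ((w a * w b : ℝ) : ℂ) * e (((n a - n b : ℤ) : ℝ) * x) := by
    intro x
    rw [Complex.ofReal_pow, ← Complex.mul_conj', map_sum, Finset.sum_mul_sum]
    refine Finset.sum_congr rfl fun a _ => Finset.sum_congr rfl fun b _ => ?_
    rw [map_mul, e_conj, Complex.conj_ofReal]
    have : (((n a - n b : ℤ) : ℝ) * x) = (n a : ℝ) * x + -((n b : ℝ) * x) := by push_cast; ring
    rw [this, e_add]; push_cast; ring
  have hc : ∀ c : ℝ, Continuous fun x : ℝ => e (c * x) := fun c =>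
    e_cont.comp (continuous_const.mul continuous_id)
  have h2 : ((∫ x in (0:ℝ)..1, ‖∑ a ∈ A, (w a : ℂ) * e ((n a : ℝ) * x)‖ ^ 2 : ℝ) : ℂ) =
      ((∑ a ∈ A, ∑ b ∈ A, if n a = n b then w a * w b else 0 : ℝ) : ℂ) := by
    rw [← intervalIntegral.integral_ofReal]
    simp_rw [h1]
    rw [intervalIntegral.integral_finsetSum]
    · push_cast
      refine Finset.sum_congr rfl fun a _ => ?_
      rw [intervalIntegral.integral_finsetSum]
      · refine Finset.sum_congr rfl fun b _ => ?_
        rw [intervalIntegral.integral_const_mul]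
        have := e_integral (n a - n b)
        push_cast at this
        rw [this]
        simp only [sub_eq_zero]
        split_ifs <;> simp
      · intro b _
        exact ((hc _).const_mul _ |>.intervalIntegrable _ _)
    · intro a _
      apply Continuous.intervalIntegrable
      exact continuous_finsetSum _ fun b _ => (hc _).const_mul _
  exact_mod_cast h2

theorem hua8 (P : Finset ℕ) (N D : ℕ) (hN1 : 1 ≤ N) (hP : ∀ p ∈ P, 1 ≤ p ∧ p ≤ N) (hN : P.card ≤ N)
    (hD : ∀ n : ℕ, n ≠ 0 → n ≤ 2 * N ^ 3 → n.divisors.card ≤ D)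
    (w : ℕ → ℝ) (W : ℝ) (hw : ∀ p ∈ P, 0 ≤ w p ∧ w p ≤ W) :
    ∫ x in (0:ℝ)..1, ‖∑ p ∈ P, (w p : ℂ) * e ((p : ℝ) ^ 3 * x)‖ ^ 8 ≤
      3 * N * (W ^ 8 * ((2 * (N * N) * (N * N + N * N * (2 * D)) + (N * N) * (N * N) * ((2 * D) * (2 * D)) : ℕ) : ℝ)) := by
  set S : ℝ → ℂ := fun x => ∑ p ∈ P, (w p : ℂ) * e ((p : ℝ) ^ 3 * x) with hS
  set H : Finset ℤ := Finset.Icc (-(N:ℤ)) N with hH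
  set A : ℤ → Finset ((ℕ × ℕ) × (ℕ × ℕ)) := fun h =>
    ((P ×ˢ P).filter (fun z : ℕ × ℕ => (z.1:ℤ) - z.2 = h)) ×ˢ (P ×ˢ P) with hA
  set fr : ((ℕ × ℕ) × (ℕ × ℕ)) → ℤ := fun q =>
    (q.1.1:ℤ)^3 - (q.1.2:ℤ)^3 + ((q.2.1:ℤ)^3 + (q.2.2:ℤ)^3) with hfr
  set ww : ((ℕ × ℕ) × (ℕ × ℕ)) → ℝ := fun q => (w q.1.1 * w q.1.2) * (w q.2.1 * w q.2.2) with hww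
  set F : ℤ → ℝ → ℂ := fun h x => ∑ q ∈ A h, (ww q : ℂ) * e ((fr q : ℝ) * x) with hF
  have hc : ∀ c : ℝ, Continuous fun x : ℝ => e (c * x) := fun c =>
    e_cont.comp (continuous_const.mul continuous_id)
  have hFc : ∀ h, Continuous (F h) := fun h =>
    continuous_finsetSum _ fun q _ => (hc _).const_mul _
  have hSc : Continuous S := continuous_finsetSum _ fun q _ => (hc _).const_mul _
  have hHcard : (H.card : ℝ) ≤ 3 * N := by
    have : H.card ≤ 3 * N := by rw [hH, Int.card_Icc]; omega
    exact_mod_cast this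
  -- pointwise bound
  have hpt : ∀ x, ‖S x‖ ^ 8 ≤ 3 * N * ∑ h ∈ H, ‖F h x‖ ^ 2 := by
    intro x
    set Dh : ℤ → ℂ := fun h => ∑ z ∈ (P ×ˢ P).filter (fun z : ℕ × ℕ => (z.1:ℤ) - z.2 = h),
      ((w z.1 * w z.2 : ℝ) : ℂ) * e (((z.1:ℝ)^3 - (z.2:ℝ)^3) * x) with hDh
    have h1 : ((‖S x‖ ^ 2 : ℝ) : ℂ) = ∑ h ∈ H, Dh h := by
      rw [hDh, Finset.sum_fiberwise_of_maps_to, Complex.ofReal_pow, ← Complex.mul_conj', hS,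
        map_sum, Finset.sum_mul_sum, Finset.sum_product]
      · refine Finset.sum_congr rfl fun a _ => Finset.sum_congr rfl fun b _ => ?_
        rw [map_mul, e_conj, Complex.conj_ofReal]
        have : (((a:ℝ)^3 - (b:ℝ)^3) * x) = (a : ℝ)^3 * x + -((b : ℝ)^3 * x) := by ring
        rw [this, e_add]; push_cast; ring
      · intro z hz
        rw [Finset.mem_product] at hz
        have := hP _ hz.1
        have := hP _ hz.2
        rw [hH, Finset.mem_Icc]
        omega
    have h2 : ∀ h, F h x = Dh h * S x ^ 2 := by
      intro h
      rw [hF, hDh, hS, hA]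
      simp only
      rw [pow_two, Finset.sum_mul_sum, ← Finset.sum_product', Finset.sum_mul_sum,
        ← Finset.sum_product']
      refine Finset.sum_congr rfl fun q _ => ?_
      have : ((fr q : ℝ) * x) = ((q.1.1:ℝ)^3 - (q.1.2:ℝ)^3) * x + ((q.2.1:ℝ)^3 * x + (q.2.2:ℝ)^3 * x) := by
        rw [hfr]; push_cast; ring
      rw [this, e_add, e_add, hww]; push_cast; ring
    have h3 : ‖S x‖ ^ 2 ≤ ∑ h ∈ H, ‖Dh h‖ := by
      have : ‖S x‖ ^ 2 = ‖((‖S x‖ ^ 2 : ℝ) : ℂ)‖ := by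
        rw [Complex.norm_real, Real.norm_of_nonneg (by positivity)]
      rw [this, h1]
      exact norm_sum_le _ _
    have h4 : (‖S x‖ ^ 2) ^ 2 ≤ H.card * ∑ h ∈ H, ‖Dh h‖ ^ 2 :=
      (pow_le_pow_left₀ (by positivity) h3 2).trans sq_sum_le_card_mul_sum_sq
    calc ‖S x‖ ^ 8 = (‖S x‖ ^ 2) ^ 2 * ‖S x‖ ^ 4 := by ring
      _ ≤ (H.card * ∑ h ∈ H, ‖Dh h‖ ^ 2) * ‖S x‖ ^ 4 := by gcongr
      _ ≤ (3 * N * ∑ h ∈ H, ‖Dh h‖ ^ 2) * ‖S x‖ ^ 4 := by gcongr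
      _ = 3 * N * ∑ h ∈ H, ‖F h x‖ ^ 2 := by
        rw [mul_assoc, Finset.sum_mul]
        congr 1
        refine Finset.sum_congr rfl fun h _ => ?_
        rw [h2, norm_mul, norm_pow]; ring
  have hint : ∫ x in (0:ℝ)..1, ‖S x‖ ^ 8 ≤ ∫ x in (0:ℝ)..1, 3 * N * ∑ h ∈ H, ‖F h x‖ ^ 2 := by
    apply intervalIntegral.integral_mono_on (by norm_num)
    · exact (hSc.norm.pow 8).intervalIntegrable _ _
    · apply Continuous.intervalIntegrable
      exact (continuous_finsetSum _ fun h _ => (hFc h).norm.pow 2).const_mul _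
    · intro x _; exact hpt x
  refine hint.trans ?_
  rw [intervalIntegral.integral_const_mul, intervalIntegral.integral_finsetSum]
  swap
  · intro h _
    exact ((hFc h).norm.pow 2).intervalIntegrable _ _
  gcongr
  have hM := M_count P N D hP hN hD
  have hwb : ∀ h, ∀ q ∈ A h, 0 ≤ ww q ∧ ww q ≤ W ^ 4 := by
    rintro h ⟨⟨a, b⟩, ⟨c, d⟩⟩ hq
    simp only [hA, Finset.mem_product, Finset.mem_filter] at hq
    have ha := hw a hq.1.1.1
    have hb := hw b hq.1.1.2
    have hc := hw c hq.2.1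
    have hd := hw d hq.2.2
    have hW : 0 ≤ W := ha.1.trans ha.2
    simp only [hww]
    refine ⟨mul_nonneg (mul_nonneg ha.1 hb.1) (mul_nonneg hc.1 hd.1), ?_⟩
    calc _ ≤ (W * W) * (W * W) :=
          mul_le_mul (mul_le_mul ha.2 hb.2 hb.1 hW) (mul_le_mul hc.2 hd.2 hd.1 hW)
            (mul_nonneg hc.1 hd.1) (mul_nonneg hW hW)
      _ = W ^ 4 := by ring
  calc ∑ h ∈ H, ∫ x in (0:ℝ)..1, ‖F h x‖ ^ 2
      = ∑ h ∈ H, ∑ a ∈ A h, ∑ b ∈ A h, if fr a = fr b then ww a * ww b else 0 := by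
        refine Finset.sum_congr rfl fun h _ => ?_
        exact parseval (A h) ww fr
    _ ≤ ∑ h ∈ H, ∑ a ∈ A h, ∑ b ∈ A h, if fr a = fr b then W ^ 8 else 0 := by
        refine Finset.sum_le_sum fun h _ => Finset.sum_le_sum fun a ha =>
          Finset.sum_le_sum fun b hb => ?_
        split_ifs
        · have h1 := hwb h a ha
          have h2 := hwb h b hb
          calc _ ≤ W ^ 4 * W ^ 4 := mul_le_mul h1.2 h2.2 h2.1 (by positivity)
            _ = W ^ 8 := by ring
        · exact le_rfl
    _ = W ^ 8 * ((∑ h ∈ H, ((A h ×ˢ A h).filter (fun t => fr t.1 = fr t.2)).card : ℕ) : ℝ) := by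
        push_cast
        rw [Finset.mul_sum]
        refine Finset.sum_congr rfl fun h _ => ?_
        rw [← Finset.sum_product' (A h) (A h) (fun a b => if fr a = fr b then W ^ 8 else 0),
          ← Finset.sum_filter, Finset.sum_const, nsmul_eq_mul, mul_comm]
    _ ≤ _ := by
        gcongr
        refine le_trans ?_ hM
        rw [Finset.card_eq_sum_card_fiberwise (t := H) (f := fun t => (t.1.1.1:ℤ) - t.1.1.2)]
        · refine Finset.sum_le_sum fun h _ => Finset.card_le_card ?_
          intro t ht
          simp only [hA, hfr, Finset.mem_filter, Finset.mem_product] at ht ⊢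
          obtain ⟨⟨⟨⟨h1, h2⟩, h3⟩, ⟨h4, h5⟩, h6⟩, h7⟩ := ht
          exact ⟨⟨⟨⟨h1, h3⟩, h4, h6⟩, h2.trans h5.symm, h7⟩, h2⟩
        · intro t ht
          simp only [Finset.coe_filter, Set.mem_ofPred_eq, Finset.mem_product] at ht
          have := hP _ ht.1.1.1.1
          have := hP _ ht.1.1.1.2
          rw [hH, Finset.mem_coe, Finset.mem_Icc]
          dsimp only
          omega

theorem Kf_nonneg (τ α : ℝ) : 0 ≤ Kf τ α := by
  unfold Kf; split_ifs <;> positivity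

theorem Kf_le (τ α : ℝ) (hτ : 0 < τ) : Kf τ α ≤ 2 * τ ^ 2 * (1 + (τ * α) ^ 2)⁻¹ := by
  rw [← div_eq_mul_inv, le_div_iff₀ (by positivity)]
  unfold Kf
  split_ifs with h
  · subst h; nlinarith [sq_nonneg τ]
  · have hpi := Real.pi_pos
    have hpi3 := Real.pi_gt_three
    have hpa : Real.pi * α ≠ 0 := by positivity
    rw [div_pow, div_mul_eq_mul_div, div_le_iff₀ (by positivity)]
    have h1 : (Real.sin (Real.pi * τ * α)) ^ 2 ≤ 1 := Real.sin_sq_le_one _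
    have h2 : (Real.sin (Real.pi * τ * α)) ^ 2 ≤ (Real.pi * τ * α) ^ 2 := by
      rw [sq_le_sq]
      exact Real.abs_sin_le_abs
    have h3 : (τ * α) ^ 2 * (Real.sin (Real.pi * τ * α)) ^ 2 ≤ (τ * α) ^ 2 :=
      mul_le_of_le_one_right (by positivity) h1
    have h4 : (τ * α) ^ 2 ≤ (Real.pi * τ * α) ^ 2 := by
      have : (Real.pi * τ * α) ^ 2 = Real.pi ^ 2 * (τ * α) ^ 2 := by ring
      rw [this]
      exact le_mul_of_one_le_left (by positivity) (by nlinarith)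
    nlinarith

theorem Kf_meas (τ : ℝ) : Measurable (Kf τ) := by
  unfold Kf
  refine Measurable.ite (measurableSet_singleton 0) measurable_const ?_
  fun_prop

theorem W_lint (τ : ℝ) (hτ : 0 < τ) :
    ∫⁻ α : ℝ, ENNReal.ofReal (2 * τ ^ 2 * (1 + (τ * α) ^ 2)⁻¹) = ENNReal.ofReal (2 * Real.pi * τ) := by
  rw [← ofReal_integral_eq_lintegral_ofReal]
  · congr 1
    rw [integral_const_mul, Measure.integral_comp_mul_left (fun x : ℝ => (1 + x ^ 2)⁻¹) τ,
      integral_univ_inv_one_add_sq, abs_of_pos (by positivity), smul_eq_mul]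
    field_simp
  · exact (integrable_inv_one_add_sq.comp_mul_left' hτ.ne').const_mul _
  · exact Filter.Eventually.of_forall fun x => by positivity

theorem period_bound (g : ℝ → ENNReal) (hg : Measurable g) (I : ENNReal)
    (hI : ∀ x : ℝ, ∫⁻ s in Set.Icc (0:ℝ) 1, g (x - s) ≤ I) (l τ : ℝ) (hl : 0 < l)
    (hτ : 0 < τ) (hτ1 : τ < 1) :
    ∫⁻ α : ℝ, g (l * α) * ENNReal.ofReal (Kf τ α) ≤
      ENNReal.ofReal ((2 + 2 / l ^ 2) * (2 * Real.pi * τ)) * I := by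
  set W : ℝ → ℝ := fun α => 2 * τ ^ 2 * (1 + (τ * α) ^ 2)⁻¹ with hW
  have hWm : Measurable fun α => ENNReal.ofReal (W α) := by rw [hW]; fun_prop
  set c : ℝ := 2 + 2 / l ^ 2 with hc
  have hcpos : 0 < c := by positivity
  have hWle : ∀ α, ∀ s ∈ Set.Icc (0:ℝ) 1, W α ≤ c * W (α + s / l) := by
    intro α s hs
    have hs2 : (s / l) ^ 2 ≤ 1 / l ^ 2 := by
      rw [div_pow]
      gcongr
      nlinarith [hs.1, hs.2]
    have hτ2 : τ ^ 2 ≤ 1 := by nlinarith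
    have h1 : 1 + (τ * (α + s / l)) ^ 2 ≤ c * (1 + (τ * α) ^ 2) := by
      have a1 : (τ * (α + s / l)) ^ 2 ≤ 2 * (τ * α) ^ 2 + 2 * (τ ^ 2 * (s / l) ^ 2) := by
        nlinarith [sq_nonneg (τ * α - τ * (s / l))]
      have a2 : τ ^ 2 * (s / l) ^ 2 ≤ 1 / l ^ 2 := by
        calc _ ≤ 1 * (1 / l ^ 2) := by gcongr
          _ = _ := one_mul _
      have a3 : c * (1 + (τ * α) ^ 2) = 2 + 2 * (1 / l ^ 2) + 2 * (τ * α) ^ 2 + 2 / l ^ 2 * (τ * α) ^ 2 := by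
        rw [hc]; ring
      have a4 : 0 ≤ 2 / l ^ 2 * (τ * α) ^ 2 := by positivity
      linarith
    have h2 : (1 + (τ * α) ^ 2)⁻¹ ≤ c * (1 + (τ * (α + s / l)) ^ 2)⁻¹ := by
      rw [← div_eq_mul_inv, inv_eq_one_div, div_le_div_iff₀ (by positivity) (by positivity)]
      linarith
    calc W α = 2 * τ ^ 2 * (1 + (τ * α) ^ 2)⁻¹ := rfl
      _ ≤ 2 * τ ^ 2 * (c * (1 + (τ * (α + s / l)) ^ 2)⁻¹) := by gcongr
      _ = _ := by rw [hW]; ring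
  have hW2 : ∀ α, ENNReal.ofReal (W α) ≤
      ENNReal.ofReal c * ∫⁻ s in Set.Icc (0:ℝ) 1, ENNReal.ofReal (W (α + s / l)) := by
    intro α
    rw [← lintegral_const_mul _ (by rw [hW]; fun_prop)]
    calc ENNReal.ofReal (W α) = ∫⁻ s in Set.Icc (0:ℝ) 1, ENNReal.ofReal (W α) := by
          simp
      _ ≤ _ := by
          apply setLIntegral_mono' measurableSet_Icc
          intro s hs
          rw [← ENNReal.ofReal_mul hcpos.le]
          exact ENNReal.ofReal_le_ofReal (hWle α s hs)
  calc ∫⁻ α : ℝ, g (l * α) * ENNReal.ofReal (Kf τ α)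
      ≤ ∫⁻ α : ℝ, g (l * α) *
        (ENNReal.ofReal c * ∫⁻ s in Set.Icc (0:ℝ) 1, ENNReal.ofReal (W (α + s / l))) := by
        apply lintegral_mono
        intro α
        exact mul_le_mul_right ((ENNReal.ofReal_le_ofReal (Kf_le τ α hτ)).trans (hW2 α)) _
    _ = ENNReal.ofReal c * ∫⁻ α : ℝ, ∫⁻ s in Set.Icc (0:ℝ) 1,
          g (l * α) * ENNReal.ofReal (W (α + s / l)) := by
        rw [← lintegral_const_mul' _ _ ENNReal.ofReal_ne_top]
        apply lintegral_congr
        intro α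
        rw [lintegral_const_mul _ (by rw [hW]; fun_prop)]
        ring
    _ = ENNReal.ofReal c * ∫⁻ s in Set.Icc (0:ℝ) 1, ∫⁻ α : ℝ,
          g (l * α) * ENNReal.ofReal (W (α + s / l)) := by
        rw [lintegral_lintegral_swap]
        apply Measurable.aemeasurable
        simp only [hW, Function.uncurry_def]
        fun_prop
    _ = ENNReal.ofReal c * ∫⁻ s in Set.Icc (0:ℝ) 1, ∫⁻ u : ℝ,
          g (l * u - s) * ENNReal.ofReal (W u) := by
        congr 1
        apply lintegral_congr
        intro s
        rw [← lintegral_add_right_eq_self (fun u => g (l * u - s) * ENNReal.ofReal (W u)) (s / l)]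
        apply lintegral_congr
        intro α
        have : l * (α + s / l) - s = l * α := by field_simp; ring
        rw [this]
    _ = ENNReal.ofReal c * ∫⁻ u : ℝ, ∫⁻ s in Set.Icc (0:ℝ) 1,
          g (l * u - s) * ENNReal.ofReal (W u) := by
        rw [lintegral_lintegral_swap]
        apply Measurable.aemeasurable
        simp only [hW, Function.uncurry_def]
        fun_prop
    _ ≤ ENNReal.ofReal c * ∫⁻ u : ℝ, I * ENNReal.ofReal (W u) := by
        gcongr with u
        rw [lintegral_mul_const _ (by fun_prop)]
        gcongr
        exact hI _
    _ = _ := by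
        rw [lintegral_const_mul _ hWm, hW, W_lint τ hτ, ENNReal.ofReal_mul hcpos.le]
        ring

theorem SS_cont (η X : ℝ) (k : ℕ) : Continuous (SS η X k) := by
  unfold SS
  exact continuous_finsetSum _ fun q _ =>
    (e_cont.comp (continuous_const.mul continuous_id)).const_mul _

theorem S2_cont (η X : ℝ) : Continuous (S2 η X) := by
  unfold S2
  exact continuous_finsetSum _ fun q _ =>
    (e_cont.comp (continuous_const.mul continuous_id)).const_mul _

theorem SS_periodic (η X : ℝ) (k : ℕ) : Function.Periodic (SS η X k) 1 := by
  intro x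
  unfold SS
  refine Finset.sum_congr rfl fun p _ => ?_
  have : (p:ℝ) ^ k * (x + 1) = (p:ℝ)^k * x + ((p ^ k : ℤ) : ℝ) := by push_cast; ring
  rw [this, e_add, e_int, mul_one]

theorem log_bd (X : ℝ) (hX : 1 ≤ X) (k : ℕ) (hk : 1 ≤ k) (p : ℕ) (hp : 1 ≤ p)
    (hp2 : p ≤ ⌊X ^ ((1:ℝ)/(k:ℝ))⌋₊) : 0 ≤ Real.log p ∧ Real.log p ≤ Real.log X := by
  have hp' : (1:ℝ) ≤ p := by exact_mod_cast hp
  refine ⟨Real.log_nonneg hp', Real.log_le_log (by linarith) ?_⟩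
  calc (p:ℝ) ≤ X ^ ((1:ℝ)/(k:ℝ)) := (Nat.le_floor_iff (by positivity)).mp hp2
    _ ≤ X ^ (1:ℝ) := by
        apply Real.rpow_le_rpow_of_exponent_le hX
        rw [div_le_one (by positivity)]
        exact_mod_cast hk
    _ = X := Real.rpow_one X

theorem SS_triv (η X : ℝ) (hX : 1 ≤ X) (k : ℕ) (hk : 1 ≤ k) (α : ℝ) :
    ‖SS η X k α‖ ≤ X ^ ((1:ℝ)/(k:ℝ)) * Real.log X := by
  have hL := Real.log_nonneg hX
  unfold SS
  refine (norm_sum_le _ _).trans ?_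
  refine (Finset.sum_le_sum (g := fun _ => Real.log X) ?_).trans ?_
  · intro p hp
    simp only [Finset.mem_filter, Finset.mem_Icc] at hp
    obtain ⟨h1, h2⟩ := log_bd X hX k hk p hp.1.1 hp.1.2
    rw [norm_mul, e_norm, mul_one, Complex.norm_real, Real.norm_of_nonneg h1]
    exact h2
  · rw [Finset.sum_const, nsmul_eq_mul]
    gcongr
    calc _ ≤ ((Finset.Icc 1 ⌊X ^ ((1:ℝ)/(k:ℝ))⌋₊).card : ℝ) := by
          exact_mod_cast Finset.card_filter_le _ _
      _ = (⌊X ^ ((1:ℝ)/(k:ℝ))⌋₊ : ℝ) := by simp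
      _ ≤ _ := Nat.floor_le (by positivity)

theorem hua_SS : ∃ C > (0:ℝ), ∀ η X : ℝ, 1 ≤ X →
    ∫ x in (0:ℝ)..1, ‖SS η X 3 x‖ ^ 8 ≤ C * (X ^ ((5:ℝ)/3 + 1/1000) * Real.log X ^ 8) := by
  obtain ⟨C, hC, hdiv⟩ := div_bound (1/2000) (by norm_num)
  refine ⟨3 * 10 * (C * 2) ^ 2, by positivity, fun η X hX => ?_⟩
  have hX0 : 0 < X := by linarith
  have hL := Real.log_nonneg hX
  set Y : ℝ := X ^ ((1:ℝ)/((3:ℕ):ℝ)) with hY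
  have hY1 : 1 ≤ Y := Real.one_le_rpow hX (by positivity)
  set N : ℕ := ⌊Y⌋₊ with hN
  have hNY : (N:ℝ) ≤ Y := Nat.floor_le (by positivity)
  have hN1 : 1 ≤ N := Nat.le_floor (by simpa using hY1)
  have hY3 : Y ^ 3 = X := by
    rw [hY, ← Real.rpow_natCast, ← Real.rpow_mul hX0.le]; norm_num
  set Q : ℝ := C * (2 * X) ^ ((1:ℝ)/2000) with hQ
  have hQ1 : 1 ≤ Q := by
    have : 1 ≤ (2 * X) ^ ((1:ℝ)/2000) := Real.one_le_rpow (by linarith) (by norm_num)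
    nlinarith
  have hQX : Q ≤ (C * 2) * X ^ ((1:ℝ)/2000) := by
    rw [hQ, Real.mul_rpow (by norm_num) hX0.le, mul_assoc]
    have : (2:ℝ) ^ ((1:ℝ)/2000) ≤ 2 ^ (1:ℝ) :=
      Real.rpow_le_rpow_of_exponent_le (by norm_num) (by norm_num)
    rw [Real.rpow_one] at this
    gcongr
  set D : ℕ := ⌊Q⌋₊ with hDdef
  have hDQ : (D:ℝ) ≤ Q := Nat.floor_le (by linarith)
  have hD : ∀ n : ℕ, n ≠ 0 → n ≤ 2 * N ^ 3 → n.divisors.card ≤ D := by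
    intro n hn hn2
    apply Nat.le_floor
    refine (hdiv n hn).trans ?_
    rw [hQ]
    gcongr
    calc (n:ℝ) ≤ 2 * (N:ℝ) ^ 3 := by exact_mod_cast hn2
      _ ≤ 2 * Y ^ 3 := by gcongr
      _ = 2 * X := by rw [hY3]
  have key := hua8 ((Finset.Icc 1 N).filter
      (fun p : ℕ => p.Prime ∧ (η * X) ^ ((1:ℝ)/((3:ℕ):ℝ)) ≤ (p : ℝ))) N D hN1
      (by intro p hp; simp only [Finset.mem_filter, Finset.mem_Icc] at hp; exact hp.1)
      (by refine (Finset.card_filter_le _ _).trans ?_; simp) hD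
      (fun p => Real.log p) (Real.log X)
      (by
        intro p hp; simp only [Finset.mem_filter, Finset.mem_Icc] at hp
        exact log_bd X hX 3 (by norm_num) p hp.1.1 hp.1.2)
  have key' : ∫ x in (0:ℝ)..1, ‖SS η X 3 x‖ ^ 8 ≤ _ := key
  refine key'.trans ?_
  push_cast
  calc _ = 3 * (N:ℝ) ^ 5 * Real.log X ^ 8 * (2 + 4 * (D:ℝ) + 4 * (D:ℝ) ^ 2) := by ring
    _ ≤ 3 * Y ^ 5 * Real.log X ^ 8 * (2 + 4 * Q + 4 * Q ^ 2) := by gcongr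
    _ ≤ 3 * Y ^ 5 * Real.log X ^ 8 * (10 * Q ^ 2) := by
        gcongr
        nlinarith
    _ ≤ 3 * Y ^ 5 * Real.log X ^ 8 * (10 * ((C * 2) * X ^ ((1:ℝ)/2000)) ^ 2) := by gcongr
    _ = 3 * 10 * (C * 2) ^ 2 * ((Y ^ 5 * (X ^ ((1:ℝ)/2000)) ^ 2) * Real.log X ^ 8) := by ring
    _ = _ := by
        congr 2
        rw [hY, ← Real.rpow_natCast, ← Real.rpow_natCast, ← Real.rpow_mul hX0.le,
          ← Real.rpow_mul hX0.le, ← Real.rpow_add hX0]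
        norm_num

theorem SS_lint (η X I : ℝ) (hI : ∫ x in (0:ℝ)..1, ‖SS η X 3 x‖ ^ 8 ≤ I) (x : ℝ) :
    ∫⁻ s in Set.Icc (0:ℝ) 1, ENNReal.ofReal (‖SS η X 3 (x - s)‖ ^ 8) ≤ ENNReal.ofReal I := by
  have hcont : Continuous fun s => ‖SS η X 3 (x - s)‖ ^ 8 :=
    ((SS_cont η X 3).comp (continuous_const.sub continuous_id)).norm.pow 8
  rw [← ofReal_integral_eq_lintegral_ofReal]
  · apply ENNReal.ofReal_le_ofReal
    rw [integral_Icc_eq_integral_Ioc, ← intervalIntegral.integral_of_le (by norm_num)]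
    rw [intervalIntegral.integral_comp_sub_left (fun y => ‖SS η X 3 y‖ ^ 8) x]
    have hp : Function.Periodic (fun y => ‖SS η X 3 y‖ ^ 8) 1 := by
      intro y; simp only [SS_periodic η X 3 y]
    have := hp.intervalIntegral_add_eq (x - 1) 0
    simp only [sub_add_cancel, zero_add] at this
    rw [sub_zero, this]
    exact hI
  · exact hcont.continuousOn.integrableOn_compact isCompact_Icc
  · exact Filter.Eventually.of_forall fun x => by positivity

theorem m2_ge (k : ℕ) (hk : 5 ≤ k) : 12 ≤ m2 k := by
  unfold m2
  split_ifs with h h'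
  · subst h
    have hf : ⌊2 * ((5:ℕ):ℝ)/3⌋ = 3 := by
      rw [Int.floor_eq_iff]; norm_num
    rw [hf]
    have : (5:ℤ) < ⌈(2 * ((5:ℕ):ℝ)/3 + 1 - ((3:ℤ):ℝ)) * (2:ℝ) ^ ((3:ℤ) - 1)⌉ := by
      rw [Int.lt_ceil]
      norm_num
    have h6 : (6:ℤ) ≤ ⌈(2 * ((5:ℕ):ℝ)/3 + 1 - ((3:ℤ):ℝ)) * (2:ℝ) ^ ((3:ℤ) - 1)⌉ := this
    have : ((6:ℤ):ℝ) ≤ (⌈(2 * ((5:ℕ):ℝ)/3 + 1 - ((3:ℤ):ℝ)) * (2:ℝ) ^ ((3:ℤ) - 1)⌉ : ℝ) := by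
      exact_mod_cast h6
    norm_num at this ⊢
  · have hk6 : (6:ℝ) ≤ k := by exact_mod_cast (by omega : 6 ≤ k)
    have := Int.le_ceil (14 * (k:ℝ)/3 - 20)
    linarith
  · have hk8 : (8:ℝ) ≤ k := by exact_mod_cast (by omega : 8 ≤ k)
    have h5 : (5:ℤ) ≤ ⌊2 * (k:ℝ)/3⌋ := by
      rw [Int.le_floor]; push_cast; linarith
    have h5' : (5:ℝ) ≤ (⌊2 * (k:ℝ)/3⌋ : ℝ) := by exact_mod_cast h5
    have hfl := Int.floor_le (2 * (k:ℝ)/3)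
    have := Int.le_ceil ((2 * (k:ℝ)/3 - (⌊2 * (k:ℝ)/3⌋ : ℝ)/2) * ((⌊2 * (k:ℝ)/3⌋ : ℝ) + 1))
    nlinarith

theorem amgm (a b c d : ℝ) : (a * b * c * d) ^ 2 ≤ a ^ 8 + b ^ 8 + c ^ 8 + d ^ 8 := by
  have h1 := sq_nonneg (a ^ 2 * b ^ 2 - c ^ 2 * d ^ 2)
  have h2 := sq_nonneg (a ^ 4 - b ^ 4)
  have h3 := sq_nonneg (c ^ 4 - d ^ 4)
  have h4 : 0 ≤ a ^ 8 + b ^ 8 + c ^ 8 + d ^ 8 := by positivity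
  nlinarith

/-- bound for the minor-arc piece `𝔪₁`. -/
theorem minor_arc_m1_bound (k : ℕ) (hk : 5 ≤ k)
    (l1 l2 l3 l4 l5 l6 l7 : ℝ)
    (h1 : 0 < l1) (h2 : 0 < l2) (h3 : 0 < l3) (h4 : 0 < l4)
    (h5 : 0 < l5) (h6 : 0 < l6) (h7 : 0 < l7)
    (η : ℝ) (hη : 0 < η) (hη1 : η < 1) :
    ∃ ε₀ > (0:ℝ), ∀ ε : ℝ, 0 < ε → ε ≤ ε₀ →
    ∃ C > (0:ℝ), ∃ X₀ : ℝ, ∀ X ≥ X₀, ∀ τ : ℝ, 0 < τ → τ < 1 →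
      (∫ α in {α : ℝ | X ^ ((1:ℝ)/4 - ε) / X < |α| ∧
            |α| < (1/τ^2) * X ^ ((5*(k:ℝ) - 12)/(32*(k:ℝ))) * (Real.log X) ^ 3 ∧
            ‖S2 η X (l1 * α)‖ ≤ X ^ ((3:ℝ)/7 + 2*ε)},
          ‖S2 η X (l1 * α) * SS η X 3 (l2 * α) * SS η X 3 (l3 * α) *
            SS η X 3 (l4 * α) * SS η X 3 (l5 * α) * SS η X 4 (l6 * α) *
            SS η X k (l7 * α)‖ ^ 2 * Kf τ α)
        ≤ C * τ * X ^ ((13:ℝ)/6 + 2/(k:ℝ) + 75/84 - 2/(7 * m2 k) + ε) := by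
  obtain ⟨C₁, hC₁, hHua⟩ := hua_SS
  have hm2 := m2_ge k hk
  set cc : ℝ → ℝ := fun l => (2 + 2 / l ^ 2) * (2 * Real.pi) with hcc
  have hpi := Real.pi_pos
  have hccpos : ∀ l : ℝ, 0 ≤ cc l := by intro l; rw [hcc]; positivity
  refine ⟨1/1000, by norm_num, fun ε hε hε0 => ?_⟩
  refine ⟨(cc l2 + cc l3 + cc l4 + cc l5 + 1) * C₁ * 2000 ^ 12, by
    have := hccpos l2; have := hccpos l3; have := hccpos l4; have := hccpos l5
    positivity, 1, fun X hX τ hτ hτ1 => ?_⟩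
  have hX1 : 1 ≤ X := hX
  have hX0 : 0 < X := by linarith
  have hL := Real.log_nonneg hX1
  set L := Real.log X with hLdef
  set I : ℝ := C₁ * (X ^ ((5:ℝ)/3 + 1/1000) * L ^ 8) with hI
  have hI0 : 0 ≤ I := by positivity
  set B : ℝ := (X ^ ((3:ℝ)/7 + 2*ε)) ^ 2 * (X ^ ((1:ℝ)/((4:ℕ):ℝ)) * L) ^ 2 * (X ^ ((1:ℝ)/(k:ℝ)) * L) ^ 2 with hB
  have hB0 : 0 ≤ B := by positivity
  set g : ℝ → ENNReal := fun y => ENNReal.ofReal (‖SS η X 3 y‖ ^ 8) with hg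
  have hgm : Measurable g := by
    have : Continuous g := ENNReal.continuous_ofReal.comp ((SS_cont η X 3).norm.pow 8)
    exact this.measurable
  have hper : ∀ l : ℝ, 0 < l → ∫⁻ α : ℝ, g (l * α) * ENNReal.ofReal (Kf τ α) ≤
      ENNReal.ofReal (cc l * τ * I) := by
    intro l hl
    refine (period_bound g hgm (ENNReal.ofReal I) (SS_lint η X I (hHua η X hX1)) l τ hl hτ hτ1).trans ?_
    rw [← ENNReal.ofReal_mul (by positivity)]
    apply ENNReal.ofReal_le_ofReal
    rw [hcc]; apply le_of_eq; ring
  set A : Set ℝ := {α : ℝ | X ^ ((1:ℝ)/4 - ε) / X < |α| ∧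
            |α| < (1/τ^2) * X ^ ((5*(k:ℝ) - 12)/(32*(k:ℝ))) * L ^ 3 ∧
            ‖S2 η X (l1 * α)‖ ≤ X ^ ((3:ℝ)/7 + 2*ε)} with hA
  have hAm : MeasurableSet A := by
    have hS2c : Continuous fun α => ‖S2 η X (l1 * α)‖ :=
      ((S2_cont η X).comp (continuous_const.mul continuous_id)).norm
    have e1 : MeasurableSet {α : ℝ | X ^ ((1:ℝ)/4 - ε) / X < |α|} :=
      (isOpen_lt continuous_const continuous_abs).measurableSet
    have e2 : MeasurableSet {α : ℝ | |α| < (1/τ^2) * X ^ ((5*(k:ℝ) - 12)/(32*(k:ℝ))) * L ^ 3} :=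
      (isOpen_lt continuous_abs continuous_const).measurableSet
    have e3 : MeasurableSet {α : ℝ | ‖S2 η X (l1 * α)‖ ≤ X ^ ((3:ℝ)/7 + 2*ε)} :=
      (isClosed_le hS2c continuous_const).measurableSet
    exact e1.inter (e2.inter e3)
  set F : ℝ → ℝ := fun α => ‖S2 η X (l1 * α) * SS η X 3 (l2 * α) * SS η X 3 (l3 * α) *
            SS η X 3 (l4 * α) * SS η X 3 (l5 * α) * SS η X 4 (l6 * α) *
            SS η X k (l7 * α)‖ ^ 2 * Kf τ α with hF
  have hpt : ∀ α ∈ A, ‖F α‖ₑ ≤ ENNReal.ofReal B *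
      (g (l2 * α) * ENNReal.ofReal (Kf τ α) + g (l3 * α) * ENNReal.ofReal (Kf τ α)
       + g (l4 * α) * ENNReal.ofReal (Kf τ α) + g (l5 * α) * ENNReal.ofReal (Kf τ α)) := by
    intro α hα
    have hK := Kf_nonneg τ α
    have hF0 : 0 ≤ F α := by rw [hF]; positivity
    rw [Real.enorm_of_nonneg hF0, hg]
    simp only
    rw [← add_mul, ← add_mul, ← add_mul, ← ENNReal.ofReal_add (by positivity) (by positivity),
      ← ENNReal.ofReal_add (by positivity) (by positivity),
      ← ENNReal.ofReal_add (by positivity) (by positivity),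
      ← ENNReal.ofReal_mul (by positivity), ← ENNReal.ofReal_mul hB0]
    apply ENNReal.ofReal_le_ofReal
    have b1 := hα.2.2
    have b2 := SS_triv η X hX1 4 (by norm_num) (l6 * α)
    have b3 := SS_triv η X hX1 k (by omega) (l7 * α)
    have b4 := amgm ‖SS η X 3 (l2 * α)‖ ‖SS η X 3 (l3 * α)‖ ‖SS η X 3 (l4 * α)‖ ‖SS η X 3 (l5 * α)‖
    rw [hF]
    simp only [norm_mul]
    calc _ = (‖S2 η X (l1 * α)‖ ^ 2 * ‖SS η X 4 (l6 * α)‖ ^ 2 * ‖SS η X k (l7 * α)‖ ^ 2) *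
          ((‖SS η X 3 (l2 * α)‖ * ‖SS η X 3 (l3 * α)‖ * ‖SS η X 3 (l4 * α)‖ * ‖SS η X 3 (l5 * α)‖) ^ 2
          * Kf τ α) := by ring
      _ ≤ _ := by
        rw [hB]
        gcongr
  have hmeas : ∀ l : ℝ, Measurable fun α => g (l * α) * ENNReal.ofReal (Kf τ α) := by
    intro l
    have := Kf_meas τ
    fun_prop
  have hlint : ∫⁻ α in A, ‖F α‖ₑ ≤ ENNReal.ofReal (B * ((cc l2 + cc l3 + cc l4 + cc l5) * τ * I)) := by
    calc _ ≤ ∫⁻ α in A, ENNReal.ofReal B *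
      (g (l2 * α) * ENNReal.ofReal (Kf τ α) + g (l3 * α) * ENNReal.ofReal (Kf τ α)
       + g (l4 * α) * ENNReal.ofReal (Kf τ α) + g (l5 * α) * ENNReal.ofReal (Kf τ α)) :=
          setLIntegral_mono' hAm hpt
      _ ≤ ∫⁻ α, ENNReal.ofReal B *
      (g (l2 * α) * ENNReal.ofReal (Kf τ α) + g (l3 * α) * ENNReal.ofReal (Kf τ α)
       + g (l4 * α) * ENNReal.ofReal (Kf τ α) + g (l5 * α) * ENNReal.ofReal (Kf τ α)) :=
          setLIntegral_le_lintegral _ _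
      _ ≤ ENNReal.ofReal B * (ENNReal.ofReal (cc l2 * τ * I) + ENNReal.ofReal (cc l3 * τ * I)
          + ENNReal.ofReal (cc l4 * τ * I) + ENNReal.ofReal (cc l5 * τ * I)) := by
          rw [lintegral_const_mul' _ _ ENNReal.ofReal_ne_top,
            lintegral_add_right _ (hmeas l5), lintegral_add_right _ (hmeas l4),
            lintegral_add_right _ (hmeas l3)]
          gcongr
          · exact hper l2 h2
          · exact hper l3 h3
          · exact hper l4 h4
          · exact hper l5 h5
      _ = _ := by
          have q2 : 0 ≤ cc l2 * τ * I := by have := hccpos l2; positivity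
          have q3 : 0 ≤ cc l3 * τ * I := by have := hccpos l3; positivity
          have q4 : 0 ≤ cc l4 * τ * I := by have := hccpos l4; positivity
          have q5 : 0 ≤ cc l5 * τ * I := by have := hccpos l5; positivity
          rw [← ENNReal.ofReal_add q2 q3, ← ENNReal.ofReal_add (by positivity) q4,
            ← ENNReal.ofReal_add (by positivity) q5, ← ENNReal.ofReal_mul hB0]
          congr 1; ring
  have hR0 : 0 ≤ B * ((cc l2 + cc l3 + cc l4 + cc l5) * τ * I) := by
    have := hccpos l2; have := hccpos l3; have := hccpos l4; have := hccpos l5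
    positivity
  have hmain : ∫ α in A, F α ≤ B * ((cc l2 + cc l3 + cc l4 + cc l5) * τ * I) := by
    have h := (enorm_integral_le_lintegral_enorm (μ := volume.restrict A) F).trans hlint
    rw [Real.enorm_eq_ofReal_abs, ENNReal.ofReal_le_ofReal_iff hR0] at h
    exact (le_abs_self _).trans h
  refine hmain.trans ?_
  -- numerical comparison
  have hlog : L ≤ 2000 * X ^ ((1:ℝ)/2000) := by
    have := Real.log_le_rpow_div hX0.le (by norm_num : (0:ℝ) < 1/2000)
    rw [hLdef]; linarith
  have hBI : B * I ≤ C₁ * 2000 ^ 12 * X ^ ((13:ℝ)/6 + 2/(k:ℝ) + 75/84 - 2/(7 * m2 k) + ε) := by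
    have hpow : (X ^ ((3:ℝ)/7 + 2*ε)) ^ 2 * (X ^ ((1:ℝ)/((4:ℕ):ℝ))) ^ 2 * (X ^ ((1:ℝ)/(k:ℝ))) ^ 2
        * X ^ ((5:ℝ)/3 + 1/1000) * (X ^ ((1:ℝ)/2000)) ^ 12 =
        X ^ (2 * ((3:ℝ)/7 + 2*ε) + 1/2 + 2/(k:ℝ) + (5/3 + 1/1000) + 12/2000) := by
      rw [← Real.rpow_mul_natCast hX0.le, ← Real.rpow_mul_natCast hX0.le,
        ← Real.rpow_mul_natCast hX0.le, ← Real.rpow_mul_natCast hX0.le, ← Real.rpow_add hX0,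
        ← Real.rpow_add hX0, ← Real.rpow_add hX0, ← Real.rpow_add hX0]
      congr 1
      push_cast
      ring
    calc B * I = C₁ * ((X ^ ((3:ℝ)/7 + 2*ε)) ^ 2 * (X ^ ((1:ℝ)/((4:ℕ):ℝ))) ^ 2 *
          (X ^ ((1:ℝ)/(k:ℝ))) ^ 2 * X ^ ((5:ℝ)/3 + 1/1000) * L ^ 12) := by
          rw [hB, hI]; ring
      _ ≤ C₁ * ((X ^ ((3:ℝ)/7 + 2*ε)) ^ 2 * (X ^ ((1:ℝ)/((4:ℕ):ℝ))) ^ 2 *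
          (X ^ ((1:ℝ)/(k:ℝ))) ^ 2 * X ^ ((5:ℝ)/3 + 1/1000) * (2000 * X ^ ((1:ℝ)/2000)) ^ 12) := by
          gcongr
      _ = C₁ * 2000 ^ 12 * ((X ^ ((3:ℝ)/7 + 2*ε)) ^ 2 * (X ^ ((1:ℝ)/((4:ℕ):ℝ))) ^ 2 *
          (X ^ ((1:ℝ)/(k:ℝ))) ^ 2 * X ^ ((5:ℝ)/3 + 1/1000) * (X ^ ((1:ℝ)/2000)) ^ 12) := by
          ring
      _ ≤ _ := by
          rw [hpow]
          refine mul_le_mul_of_nonneg_left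
            (Real.rpow_le_rpow_of_exponent_le hX1 ?_) (by positivity)
          · have : 2 / (7 * m2 k) ≤ 1 / 42 := by
              rw [div_le_div_iff₀ (by linarith) (by norm_num)]
              linarith
            linarith
  have hE : 0 ≤ X ^ ((13:ℝ)/6 + 2/(k:ℝ) + 75/84 - 2/(7 * m2 k) + ε) := by positivity
  have hs : 0 ≤ cc l2 + cc l3 + cc l4 + cc l5 := by
    have := hccpos l2; have := hccpos l3; have := hccpos l4; have := hccpos l5
    positivity
  calc B * ((cc l2 + cc l3 + cc l4 + cc l5) * τ * I)
      = ((cc l2 + cc l3 + cc l4 + cc l5) * τ) * (B * I) := by ring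
    _ ≤ ((cc l2 + cc l3 + cc l4 + cc l5 + 1) * τ) *
        (C₁ * 2000 ^ 12 * X ^ ((13:ℝ)/6 + 2/(k:ℝ) + 75/84 - 2/(7 * m2 k) + ε)) := by
        refine mul_le_mul (mul_le_mul_of_nonneg_right (by linarith) hτ.le) hBI (by positivity)
          (by positivity)
    _ = _ := by ring
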